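/- arXiv:2105.08900 — 2 statements merged into one kernel-verified Lean document; each statement's English description precedes it below -/
import Mathlib

section
/- Let F be a Minkowski norm on a finite-dimensional real vector space E and let V ∈ E satisfy F(−V) > 1. For every y in the set A′ := { y ∈ E ∖ {0} : g_y(y,V) < −F(y) }, the Fréchet derivative at y of the map φ(y) := y + F(y)·V, namely the linear map u ↦ u + (g_y(y,u)/F(y))·V, is a linear automorphism of E. -/
/-- The fundamental tensor of a (Minkowski-type) norm `F` at `y`:
`g_y(u,v) = (1/2) D²(F²)(y)(u,v)`. -/
noncomputable def fundTensor {E : Type*} [NormedAddCommGroup E] [NormedSpace ℝ E]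
    (F : E → ℝ) (y u v : E) : ℝ :=
  (1 / 2) * iteratedFDeriv ℝ 2 (fun z => (F z) ^ 2) y ![u, v]

/-- A Minkowski norm on a finite dimensional real vector space `E`. -/
structure IsMinkowskiNorm {E : Type*} [NormedAddCommGroup E] [NormedSpace ℝ E]
    (F : E → ℝ) : Prop where
  map_zero : F 0 = 0
  pos : ∀ y : E, y ≠ 0 → 0 < F y
  smooth : ContDiffOn ℝ (⊤ : ℕ∞) F {(0 : E)}ᶜ
  homog : ∀ t : ℝ, 0 < t → ∀ y : E, F (t • y) = t * F y
  symm : ∀ y : E, y ≠ 0 → ∀ u v : E, fundTensor F y u v = fundTensor F y v u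
  posdef : ∀ y : E, y ≠ 0 → ∀ u : E, u ≠ 0 → 0 < fundTensor F y u u

/-- The derivative of a positively `2`-homogeneous function is positively `1`-homogeneous. -/
theorem fderiv_smul_of_sq_homogeneous {E : Type*} [NormedAddCommGroup E] [NormedSpace ℝ E]
    {G : E → ℝ} (hG : ∀ t : ℝ, 0 < t → ∀ x, G (t • x) = t ^ 2 * G x)
    {y : E} {t : ℝ} (ht : 0 < t) :
    fderiv ℝ G (t • y) = t • fderiv ℝ G y := by
  have h : fderiv ℝ (fun x => G (t • x)) y = t • fderiv ℝ G (t • y) :=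
    fderiv_comp_smul t
  have h' : fderiv ℝ (fun x => G (t • x)) y = t ^ 2 • fderiv ℝ G y := by
    rw [funext (hG t ht)]
    exact congrFun (fderiv_const_smul_field (f := G) (t ^ 2)) y
  rw [h, pow_two, mul_smul] at h'
  exact smul_right_injective _ ht.ne' h'

/-- Euler's identity for the second derivative of a positively `2`-homogeneous function. -/
theorem fderiv_fderiv_apply_self_of_sq_homogeneous
    {E : Type*} [NormedAddCommGroup E] [NormedSpace ℝ E]
    {G : E → ℝ} (hG : ∀ t : ℝ, 0 < t → ∀ x, G (t • x) = t ^ 2 * G x)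
    {y : E} (hd : DifferentiableAt ℝ (fderiv ℝ G) y) :
    fderiv ℝ (fderiv ℝ G) y y = fderiv ℝ G y := by
  have hline : HasDerivAt (fun t : ℝ => t • y) y 1 := by
    simpa using (hasDerivAt_id (1 : ℝ)).smul_const y
  have h₁ : HasDerivAt (fun t : ℝ => fderiv ℝ G (t • y)) (fderiv ℝ (fderiv ℝ G) y y) 1 :=
    HasFDerivAt.comp_hasDerivAt_of_eq (1 : ℝ) hd.hasFDerivAt hline (one_smul ℝ y).symm
  have h₂ : HasDerivAt (fun t : ℝ => t • fderiv ℝ G y) (fderiv ℝ G y) 1 := by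
    simpa using (hasDerivAt_id (1 : ℝ)).smul_const (fderiv ℝ G y)
  refine h₁.unique (h₂.congr_of_eventuallyEq ?_)
  filter_upwards [lt_mem_nhds (zero_lt_one' ℝ)] with t ht
  exact fderiv_smul_of_sq_homogeneous hG ht

namespace IsMinkowskiNorm

variable {E : Type*} [NormedAddCommGroup E] [NormedSpace ℝ E] {F : E → ℝ} {y : E}

theorem contDiffAt (hF : IsMinkowskiNorm F) (hy : y ≠ 0) : ContDiffAt ℝ (⊤ : ℕ∞) F y :=
  hF.smooth.contDiffAt (isOpen_compl_singleton.mem_nhds hy)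

theorem differentiableAt (hF : IsMinkowskiNorm F) (hy : y ≠ 0) : DifferentiableAt ℝ F y :=
  (hF.contDiffAt hy).differentiableAt (by simp)

theorem fundTensor_self_left (hF : IsMinkowskiNorm F) (hy : y ≠ 0) (u : E) :
    fundTensor F y y u = F y * fderiv ℝ F y u := by
  have hd : DifferentiableAt ℝ (fderiv ℝ fun z => F z ^ 2) y :=
    (((hF.contDiffAt hy).pow 2).fderiv_right (m := 1)
      (WithTop.coe_le_coe.2 (le_top : (1 + 1 : ℕ∞) ≤ ⊤))).differentiableAt one_ne_zero
  have hG : ∀ t : ℝ, 0 < t → ∀ x, F (t • x) ^ 2 = t ^ 2 * F x ^ 2 := fun t ht x => by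
    rw [hF.homog t ht, mul_pow]
  have hsq : fderiv ℝ (fun z => F z ^ 2) y u = 2 * F y * fderiv ℝ F y u := by
    rw [((hF.differentiableAt hy).hasFDerivAt.pow 2).fderiv]
    simp
  rw [fundTensor, iteratedFDeriv_two_apply]
  simp only [Matrix.cons_val_zero, Matrix.cons_val_one]
  rw [fderiv_fderiv_apply_self_of_sq_homogeneous hG hd, hsq]
  ring

end IsMinkowskiNorm

/-- A rank-one perturbation `u ↦ u + L u • V` of the identity is bijective when `1 + L V ≠ 0`. -/
theorem bijective_add_smul {E : Type*} [AddCommGroup E] [Module ℝ E]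
    (L : E →ₗ[ℝ] ℝ) (V : E) (h : 1 + L V ≠ 0) :
    Function.Bijective fun u : E => u + L u • V := by
  refine Function.bijective_iff_has_inverse.2 ⟨fun w => w - (L w / (1 + L V)) • V, ?_, ?_⟩
  · intro u
    have : L (u + L u • V) / (1 + L V) = L u := by
      rw [map_add, map_smul, smul_eq_mul]
      field_simp
    simp only [this, add_sub_cancel_right]
  · intro w
    have : L (w - (L w / (1 + L V)) • V) = L w / (1 + L V) := by
      rw [map_sub, map_smul, smul_eq_mul]
      field_simp
      ring
    simp only [this, sub_add_cancel]

/-- at every point `y` of `A' = {y ≠ 0 : g_y(y,V) < -F(y)}`, the Fréchet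
derivative of `φ(z) = z + F(z)·V`, namely the linear map `u ↦ u + (g_y(y,u)/F(y))·V`,
is a linear automorphism of `E`. -/
theorem lorentz_navigation_map_fderiv_bijective
    {E : Type*} [NormedAddCommGroup E] [NormedSpace ℝ E] [FiniteDimensional ℝ E]
    (F : E → ℝ) (hF : IsMinkowskiNorm F) (V : E) (hV : 1 < F (-V))
    (y : E) (hy : y ≠ 0) (hyV : fundTensor F y y V < -(F y)) :
    (∀ u : E, fderiv ℝ (fun z : E => z + F z • V) y u
        = u + (fundTensor F y y u / F y) • V) ∧
    IsLinearMap ℝ (fun u : E => u + (fundTensor F y y u / F y) • V) ∧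
    Function.Bijective (fun u : E => u + (fundTensor F y y u / F y) • V) := by
  have hpos := hF.pos y hy
  have hg : ∀ u, fundTensor F y y u / F y = fderiv ℝ F y u := fun u => by
    rw [hF.fundTensor_self_left hy, mul_div_cancel_left₀ _ hpos.ne']
  simp only [hg]
  refine ⟨fun u => ?_, ?_, ?_⟩
  · have h := (hasFDerivAt_id y).add ((hF.differentiableAt hy).hasFDerivAt.smul_const V)
    exact congrArg (fun A : E →L[ℝ] E => A u) h.fderiv
  · exact (LinearMap.id + (fderiv ℝ F y).toLinearMap.smulRight V).isLinear
  · have hV' : fderiv ℝ F y V < -1 := by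
      rw [← hg, div_lt_iff₀ hpos]
      linarith
    exact bijective_add_smul (fderiv ℝ F y).toLinearMap V (by
      simp only [ContinuousLinearMap.coe_coe]
      linarith)
end

section
/- Every Minkowski norm F on a finite-dimensional real vector space E is a convex function on E; in particular F(y₁ + y₂) ≤ F(y₁) + F(y₂) for all y₁, y₂ ∈ E. -/
/-- A function that is `C²` with positive semidefinite second derivative along a segment is convex
along that segment. -/
theorem convexOn_comp_line_of_fderiv_fderiv_nonneg {E : Type*} [NormedAddCommGroup E]
    [NormedSpace ℝ E] {G : E → ℝ} {U : Set E} (hU : IsOpen U)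
    (hG : ∀ y ∈ U, ContDiffAt ℝ 2 G y) {a b : E} {D : Set ℝ} (hD : Convex ℝ D)
    (h : ∀ t ∈ D, a + t • b ∈ U)
    (hG₂ : ∀ y ∈ U, 0 ≤ fderiv ℝ (fderiv ℝ G) y b b) :
    ConvexOn ℝ D (fun t : ℝ => G (a + t • b)) := by
  have hline (t : ℝ) : HasDerivAt (fun t : ℝ => a + t • b) b t := by
    simpa using ((hasDerivAt_id t).smul_const b).const_add a
  have hderiv (t : ℝ) (ht : a + t • b ∈ U) :
      HasDerivAt (fun t : ℝ => G (a + t • b)) (fderiv ℝ G (a + t • b) b) t := by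
    have hd := ((hG _ ht).differentiableAt two_ne_zero).hasFDerivAt
    exact hd.comp_hasDerivAt t (hline t)
  have hopen : IsOpen {t : ℝ | a + t • b ∈ U} := hU.preimage (by fun_prop)
  have hderiv₂ (t : ℝ) (ht : a + t • b ∈ U) :
      HasDerivAt (deriv fun t : ℝ => G (a + t • b))
        (fderiv ℝ (fderiv ℝ G) (a + t • b) b b) t := by
    have hd : HasFDerivAt (fderiv ℝ G) (fderiv ℝ (fderiv ℝ G) (a + t • b)) (a + t • b) :=
      (((hG _ ht).fderiv_right (m := 1) (by norm_num)).differentiableAt one_ne_zero).hasFDerivAt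
    have hl : HasDerivAt (fun t : ℝ => fderiv ℝ G (a + t • b))
        (fderiv ℝ (fderiv ℝ G) (a + t • b) b) t := hd.comp_hasDerivAt t (hline t)
    have hc : HasDerivAt (fun t : ℝ => fderiv ℝ G (a + t • b) b)
        (fderiv ℝ (fderiv ℝ G) (a + t • b) b b) t := by
      simpa using hl.clm_apply (hasDerivAt_const t b)
    exact hc.congr_of_eventuallyEq
      (Filter.eventuallyEq_of_mem (hopen.mem_nhds ht) fun s hs => (hderiv s hs).deriv)
  refine convexOn_of_deriv2_nonneg' hD
    (fun t ht => (hderiv t (h t ht)).differentiableAt.differentiableWithinAt)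
    (fun t ht => (hderiv₂ t (h t ht)).differentiableAt.differentiableWithinAt)
    fun t ht => ?_
  have hval : deriv^[2] (fun t : ℝ => G (a + t • b)) t
      = fderiv ℝ (fderiv ℝ G) (a + t • b) b b := (hderiv₂ t (h t ht)).deriv
  exact hval ▸ hG₂ _ (h t ht)

namespace IsMinkowskiNorm

variable {E : Type*} [NormedAddCommGroup E] [NormedSpace ℝ E] {F : E → ℝ}

theorem nonneg (hF : IsMinkowskiNorm F) (y : E) : 0 ≤ F y := by
  rcases eq_or_ne y 0 with rfl | hy
  · exact hF.map_zero.ge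
  · exact (hF.pos y hy).le

theorem map_smul_of_nonneg (hF : IsMinkowskiNorm F) {t : ℝ} (ht : 0 ≤ t) (y : E) :
    F (t • y) = t * F y := by
  rcases ht.eq_or_lt with rfl | ht
  · simp [hF.map_zero]
  · exact hF.homog t ht y

theorem contDiffAt_sq (hF : IsMinkowskiNorm F) {y : E} (hy : y ≠ 0) :
    ContDiffAt ℝ 2 (fun z => F z ^ 2) y :=
  ((hF.smooth.contDiffAt (isOpen_compl_singleton.mem_nhds hy)).of_le
    (WithTop.coe_le_coe.2 (le_top (a := (2 : ℕ∞))))).pow 2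

/-- The square of a Minkowski norm is convex along every segment avoiding the origin. -/
theorem convexOn_sq_segment (hF : IsMinkowskiNorm F) (a b : E)
    (h : ∀ t ∈ Set.Icc (0 : ℝ) 1, a + t • b ≠ 0) :
    ConvexOn ℝ (Set.Icc 0 1) (fun t : ℝ => F (a + t • b) ^ 2) := by
  refine convexOn_comp_line_of_fderiv_fderiv_nonneg (G := fun z => F z ^ 2)
    (U := {(0 : E)}ᶜ) isOpen_compl_singleton (fun y hy => hF.contDiffAt_sq hy)
    (convex_Icc 0 1) h fun y hy => ?_
  rcases eq_or_ne b 0 with rfl | hb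
  · simp
  · have hpos := hF.posdef y hy b hb
    rw [fundTensor, iteratedFDeriv_two_apply] at hpos
    simp only [Matrix.cons_val_zero, Matrix.cons_val_one] at hpos
    linarith

theorem map_add_smul_neg_le (hF : IsMinkowskiNorm F) {c : ℝ} (hc : 0 ≤ c) (hc' : c ≤ 1)
    (y : E) : F (y + c • -y) ≤ F y := by
  have hy : y + c • -y = (1 - c) • y := by module
  rw [hy, hF.map_smul_of_nonneg (by linarith)]
  nlinarith [hF.nonneg y]

theorem map_add_le (hF : IsMinkowskiNorm F) (y₁ y₂ : E) : F (y₁ + y₂) ≤ F y₁ + F y₂ := by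
  rcases eq_or_ne y₁ 0 with rfl | h₁
  · simp [hF.map_zero]
  rcases eq_or_ne y₂ 0 with rfl | h₂
  · simp [hF.map_zero]
  by_cases hopp : ∃ c : ℝ, 0 < c ∧ y₂ = c • -y₁
  · obtain ⟨c, hc, rfl⟩ := hopp
    rcases le_total c 1 with hc1 | hc1
    · linarith [hF.map_add_smul_neg_le hc.le hc1 y₁, hF.nonneg (c • -y₁)]
    · have key := hF.map_add_smul_neg_le (inv_nonneg.2 hc.le) (inv_le_one_of_one_le₀ hc1)
        (c • -y₁)
      have hy : c⁻¹ • -(c • -y₁) = y₁ := by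
        rw [← smul_neg, neg_neg, inv_smul_smul₀ hc.ne']
      rw [hy, add_comm] at key
      linarith [hF.nonneg y₁]
  · have p₁ := hF.pos _ h₁
    have p₂ := hF.pos _ h₂
    set a := F y₁ with ha
    set b := F y₂ with hb
    have hu : F (a⁻¹ • y₁) = 1 := by
      rw [hF.homog _ (inv_pos.2 p₁), ← ha, inv_mul_cancel₀ p₁.ne']
    have hv : F (b⁻¹ • y₂) = 1 := by
      rw [hF.homog _ (inv_pos.2 p₂), ← hb, inv_mul_cancel₀ p₂.ne']
    have hne : ∀ t ∈ Set.Icc (0 : ℝ) 1, a⁻¹ • y₁ + t • (b⁻¹ • y₂ - a⁻¹ • y₁) ≠ 0 := by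
      rintro t ⟨ht0, ht1⟩ h0
      have h0' : ((1 - t) * a⁻¹) • y₁ + (t * b⁻¹) • y₂ = 0 := by
        rw [← h0]; module
      rcases ht0.eq_or_lt with rfl | ht0
      · simp [p₁.ne', h₁] at h0'
      rcases ht1.eq_or_lt with rfl | ht1
      · simp [p₂.ne', h₂] at h0'
      have hs : 0 < t * b⁻¹ := by positivity
      have hr : 0 < (1 - t) * a⁻¹ := mul_pos (by linarith) (inv_pos.2 p₁)
      refine hopp ⟨(t * b⁻¹)⁻¹ * ((1 - t) * a⁻¹), by positivity, ?_⟩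
      rw [mul_smul, eq_inv_smul_iff₀ hs.ne', smul_neg]
      exact eq_neg_of_add_eq_zero_right h0'
    have hconv := (hF.convexOn_sq_segment _ _ hne).2 (Set.left_mem_Icc.2 zero_le_one)
      (Set.right_mem_Icc.2 zero_le_one) (show 0 ≤ a / (a + b) by positivity)
      (show 0 ≤ b / (a + b) by positivity) (by field_simp)
    have hpt : a⁻¹ • y₁ + (b / (a + b)) • (b⁻¹ • y₂ - a⁻¹ • y₁) = (a + b)⁻¹ • (y₁ + y₂) := by
      match_scalars <;> field_simp
      ring
    simp only [smul_eq_mul, mul_zero, mul_one, zero_add, zero_smul, add_zero, one_smul,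
      add_sub_cancel, hu, hv, one_pow, hpt, ← add_div, div_self (add_pos p₁ p₂).ne'] at hconv
    rw [hF.homog _ (inv_pos.2 (add_pos p₁ p₂))] at hconv
    have hle := (abs_le_one_iff_mul_self_le_one.2 (by rwa [sq] at hconv))
    have hle' := (abs_le.1 hle).2
    rwa [inv_mul_le_iff₀ (add_pos p₁ p₂), mul_one] at hle'

theorem convexOn (hF : IsMinkowskiNorm F) : ConvexOn ℝ Set.univ F := by
  refine ⟨convex_univ, fun x _ y _ s t hs ht _ => ?_⟩
  rw [smul_eq_mul, smul_eq_mul, ← hF.map_smul_of_nonneg hs, ← hF.map_smul_of_nonneg ht]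
  exact hF.map_add_le _ _

end IsMinkowskiNorm

/-- every Minkowski norm is a convex function; in particular it is
subadditive. -/
theorem minkowskiNorm_convexOn_and_subadditive
    {E : Type*} [NormedAddCommGroup E] [NormedSpace ℝ E] [FiniteDimensional ℝ E]
    (F : E → ℝ) (hF : IsMinkowskiNorm F) :
    ConvexOn ℝ Set.univ F ∧ ∀ y₁ y₂ : E, F (y₁ + y₂) ≤ F y₁ + F y₂ :=
  ⟨hF.convexOn, hF.map_add_le⟩
end
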